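/- For every τ in the complex upper half-plane and every z ∈ ℂ, all the values θ₁(ℓτ/3 + m/3, τ) and θ₁(−ℓτ/3 − m/3, τ) for (ℓ,m) ∈ {0,1,2}² with (ℓ,m) ≠ (0,0), as well as θ₂(0,τ), θ₃(0,τ), θ₄(0,τ), are nonzero, and the following identity holds: 3·∑_{(ℓ,m)∈{0,1,2}², (ℓ,m)≠(0,0)} [θ₁(z + ℓτ/3 + m/3, τ)·θ₁(z − ℓτ/3 − m/3, τ)] / [θ₁(ℓτ/3 + m/3, τ)·θ₁(−ℓτ/3 − m/3, τ)] = 8·[ (θ₂(z,τ)/θ₂(0,τ))² + (θ₃(z,τ)/θ₃(0,τ))² + (θ₄(z,τ)/θ₄(0,τ))² ]. -/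

import Mathlib

noncomputable section

open Complex

/-- The Jacobi theta function `θ_{(α,β)}(z,τ) = ∑_{n∈ℤ} exp(iπτ(n+α)² + 2πi(n+α)(z+β))`. -/
def jTheta (a b : ℝ) (z τ : ℂ) : ℂ :=
  ∑' n : ℤ, Complex.exp (Real.pi * Complex.I * τ * ((n : ℂ) + (a : ℂ)) ^ 2 +
    2 * Real.pi * Complex.I * ((n : ℂ) + (a : ℂ)) * (z + (b : ℂ)))

/-- `θ₁ := −θ_{(1/2,1/2)}`. -/
def theta1 (z τ : ℂ) : ℂ := -jTheta (1 / 2) (1 / 2) z τ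

/-- `θ₂ := θ_{(1/2,0)}`. -/
def theta2 (z τ : ℂ) : ℂ := jTheta (1 / 2) 0 z τ

/-- `θ₃ := θ_{(0,0)}`. -/
def theta3 (z τ : ℂ) : ℂ := jTheta 0 0 z τ

/-- `θ₄ := θ_{(0,1/2)}`. -/
def theta4 (z τ : ℂ) : ℂ := jTheta 0 (1 / 2) z τ


def eN (q : ℂ) : ℕ → ℂ
  | 0 => 1
  | k+1 => q^(2*k+1) / (1 - q^(2*k+2)) * eN q k

def eZ (q : ℂ) : ℤ → ℂ
  | Int.ofNat k => eN q k
  | Int.negSucc _ => 0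

lemma one_sub_pow_ne {q : ℂ} (h1 : ‖q‖ < 1) (k : ℕ) : 1 - q^(2*k+2) ≠ 0 := by
  intro h
  have h2 : q^(2*k+2) = 1 := by linear_combination -h
  have h3 : ‖q‖^(2*k+2) < 1 := pow_lt_one₀ (norm_nonneg _) h1 (by omega)
  rw [← norm_pow, h2] at h3
  simp at h3

lemma eN_ne {q : ℂ} (h0 : q ≠ 0) (h1 : ‖q‖ < 1) (k : ℕ) : eN q k ≠ 0 := by
  induction k with
  | zero => simp [eN]
  | succ k ih =>
    simp only [eN]
    exact mul_ne_zero (div_ne_zero (pow_ne_zero _ h0) (one_sub_pow_ne h1 k)) ih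

lemma eN_rec {q : ℂ} (h1 : ‖q‖ < 1) (k : ℕ) :
    eN q (k+1) = q^(2*k+2) * eN q (k+1) + q^(2*k+1) * eN q k := by
  simp only [eN]
  have := one_sub_pow_ne h1 k
  field_simp
  ring

lemma eZ_rec {q : ℂ} (h0 : q ≠ 0) (h1 : ‖q‖ < 1) (k : ℤ) :
    eZ q k = q^(2*k) * eZ q k + q^(2*k-1) * eZ q (k-1) := by
  rcases k with (_ | k) | k
  · simp [eZ]
    right
    change eZ q (Int.negSucc 0) = 0
    rfl
  · have e1 : (Int.ofNat (k+1)) - 1 = Int.ofNat k := by simp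
    rw [e1]
    have e2 : 2 * (Int.ofNat (k+1)) = ((2*k+2 : ℕ) : ℤ) := by simp; ring
    have e3 : 2 * (Int.ofNat (k+1)) - 1 = ((2*k+1 : ℕ) : ℤ) := by simp; ring
    rw [e3, e2, zpow_natCast, zpow_natCast]
    exact eN_rec h1 k
  · have e1 : (Int.negSucc k) - 1 = Int.negSucc (k+1) := by rfl
    rw [e1]
    simp [eZ]

lemma summable_eN {q : ℂ} (h0 : q ≠ 0) (h1 : ‖q‖ < 1) (x : ℂ) (hx : x ≠ 0) :
    Summable (fun k : ℕ => ‖eN q k * x^k‖) := by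
  apply summable_of_ratio_test_tendsto_lt_one (l := 0) one_pos
  · filter_upwards with k
    simp [eN_ne h0 h1 k, hx]
  · have hq : Filter.Tendsto (fun k : ℕ => q^k) Filter.atTop (nhds 0) :=
      tendsto_pow_atTop_nhds_zero_of_norm_lt_one h1
    have ha : Filter.Tendsto (fun k : ℕ => q^(2*k+1)) Filter.atTop (nhds 0) :=
      hq.comp (Filter.tendsto_atTop_mono (fun k => by simp; omega) Filter.tendsto_id)
    have hb : Filter.Tendsto (fun k : ℕ => q^(2*k+2)) Filter.atTop (nhds 0) :=
      hq.comp (Filter.tendsto_atTop_mono (fun k => by simp; omega) Filter.tendsto_id)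
    have hc := ((ha.div (hb.const_sub 1) (by simp)).mul_const x).norm
    simp only [zero_div, zero_mul, norm_zero] at hc
    refine hc.congr fun k => ?_
    rw [norm_norm, norm_norm, ← norm_div]
    congr 1
    simp only [eN, Pi.div_apply]
    have := eN_ne h0 h1 k
    have := one_sub_pow_ne h1 k
    field_simp
    ring

lemma summable_eZ {q : ℂ} (h0 : q ≠ 0) (h1 : ‖q‖ < 1) (x : ℂ) (hx : x ≠ 0) :
    Summable (fun k : ℤ => ‖eZ q k * x^k‖) := by
  apply Summable.of_nat_of_neg_add_one
  · simpa [eZ] using summable_eN h0 h1 x hx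
  · have : (fun n : ℕ => ‖eZ q (-((n:ℤ)+1)) * x^(-((n:ℤ)+1))‖) = fun _ => 0 := by
      funext n
      have : -((n:ℤ)+1) = Int.negSucc n := by omega
      rw [this]; simp [eZ]
    rw [this]; exact summable_zero

def Efun (q x : ℂ) : ℂ := ∑' k : ℤ, eZ q k * x^k

lemma Efun_eq {q : ℂ} (h0 : q ≠ 0) (h1 : ‖q‖ < 1) (x : ℂ) (hx : x ≠ 0) :
    Efun q x = ∑' k : ℕ, eN q k * x^k := by
  unfold Efun
  rw [← (show Function.Injective (fun n : ℕ => (n:ℤ)) from Nat.cast_injective).tsum_eq]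
  · simp [eZ]
  · intro k hk
    rcases k with k | k
    · exact ⟨k, rfl⟩
    · simp [eZ] at hk

lemma shift_eZ {q : ℂ} (h0 : q ≠ 0) (h1 : ‖q‖ < 1) (y : ℂ) (hy : y ≠ 0) :
    HasSum (fun k : ℤ => eZ q (k-1) * y^(k-1)) (Efun q y) := by
  have s : HasSum (fun k : ℤ => eZ q k * y^k) (Efun q y) :=
    (summable_eZ h0 h1 y hy).of_norm.hasSum
  have h := (Equiv.hasSum_iff (Equiv.subRight (1:ℤ))).2 s
  simpa only [Function.comp_def, Equiv.subRight_apply] using h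

lemma Efun_rec {q : ℂ} (h0 : q ≠ 0) (h1 : ‖q‖ < 1) (x : ℂ) (hx : x ≠ 0) :
    Efun q x = (1 + q * x) * Efun q (q^2*x) := by
  have hx' : q^2*x ≠ 0 := mul_ne_zero (pow_ne_zero _ h0) hx
  have s : HasSum (fun k : ℤ => eZ q k * (q^2*x)^k) (Efun q (q^2*x)) :=
    (summable_eZ h0 h1 _ hx').of_norm.hasSum
  have s2 := (shift_eZ h0 h1 _ hx').mul_left (q*x)
  have e3 : ∀ k : ℤ, eZ q k * x^k =
      eZ q k * (q^2*x)^k + (q*x) * (eZ q (k-1) * (q^2*x)^(k-1)) := by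
    intro k
    have h2 : (q^2*x)^k = q^(2*k) * x^k := by
      rw [mul_zpow, zpow_mul]; norm_cast
    have h3 : q * x * (q^2*x)^(k-1) = q^(2*k-1) * x^k := by
      rw [mul_zpow, show q^2 = q^(2:ℤ) by norm_cast, ← zpow_mul, zpow_sub_one₀ hx,
        show 2*k-1 = 2*(k-1)+1 by ring, zpow_add_one₀ h0]
      field_simp
    have h4 := eZ_rec h0 h1 k
    rw [h2]
    linear_combination x^k * h4 - eZ q (k-1) * h3
  have e4 := s.add s2
  simp_rw [← e3] at e4
  unfold Efun at e4 ⊢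
  rw [e4.tsum_eq]
  ring

lemma Efun_iter {q : ℂ} (h0 : q ≠ 0) (h1 : ‖q‖ < 1) (x : ℂ) (hx : x ≠ 0) (N : ℕ) :
    Efun q x = (∏ k ∈ Finset.range N, (1 + q^(2*k+1) * x)) * Efun q (q^(2*N)*x) := by
  induction N with
  | zero => simp
  | succ N ih =>
    rw [ih, Finset.prod_range_succ, Efun_rec h0 h1 (q^(2*N)*x) (by positivity)]
    rw [show q^2*(q^(2*N)*x) = q^(2*(N+1))*x by ring]
    ring

lemma Efun_ne {q : ℂ} (h0 : q ≠ 0) (h1 : ‖q‖ < 1) (x : ℂ) (hx : x ≠ 0)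
    (h : ∀ k : ℕ, 1 + q^(2*k+1) * x ≠ 0) : Efun q x ≠ 0 := by
  have hl : Filter.Tendsto (fun N : ℕ => Efun q (q^(2*N)*x)) Filter.atTop (nhds 1) := by
    have : ∀ N : ℕ, Efun q (q^(2*N)*x) = ∑' k : ℕ, eN q k * (q^(2*N)*x)^k := fun N =>
      Efun_eq h0 h1 _ (by positivity)
    simp_rw [this]
    have e1 : (1:ℂ) = ∑' k : ℕ, (if k = 0 then 1 else 0) := by simp
    rw [e1]
    refine tendsto_tsum_of_dominated_convergence (summable_eN h0 h1 x hx) ?_ ?_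
    · intro k
      rcases k with _ | k
      · simp [eN]
      · have hq : Filter.Tendsto (fun N : ℕ => q^(2*N)) Filter.atTop (nhds 0) :=
          (tendsto_pow_atTop_nhds_zero_of_norm_lt_one h1).comp
            (Filter.tendsto_atTop_mono (fun k => by simp; omega) Filter.tendsto_id)
        have := ((hq.mul_const x).pow (k+1)).const_mul (eN q (k+1))
        simpa using this
    · filter_upwards with N k
      rw [norm_mul, norm_mul, mul_pow, norm_mul]
      have : ‖(q^(2*N))^k‖ ≤ 1 := by
        rw [norm_pow, norm_pow]
        exact pow_le_one₀ (by positivity) (pow_le_one₀ (by positivity) h1.le)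
      have h5 : ‖(q^(2*N))^k‖ * ‖x^k‖ ≤ 1 * ‖x^k‖ := by gcongr
      rw [one_mul] at h5
      gcongr
  obtain ⟨N, hN⟩ := (hl.eventually_ne one_ne_zero).exists
  rw [Efun_iter h0 h1 x hx N]
  exact mul_ne_zero (Finset.prod_ne_zero_iff.2 fun k _ => h k) hN

def cc (q : ℂ) (n : ℤ) : ℂ := ∑' m : ℤ, eZ q (n+m) * eZ q m

lemma summable_prod {q : ℂ} (h0 : q ≠ 0) (h1 : ‖q‖ < 1) (x y : ℂ) (hx : x ≠ 0) (hy : y ≠ 0) :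
    Summable (fun p : ℤ × ℤ => eZ q (p.1+p.2) * x^(p.1+p.2) * (eZ q p.2 * y^p.2)) := by
  have := summable_mul_of_summable_norm (summable_eZ h0 h1 x hx) (summable_eZ h0 h1 y hy)
  let e : ℤ × ℤ ≃ ℤ × ℤ := ⟨fun p => (p.1+p.2, p.2), fun p => (p.1-p.2, p.2),
    fun p => by simp, fun p => by simp⟩
  exact e.summable_iff.2 this

lemma E_mul_E {q : ℂ} (h0 : q ≠ 0) (h1 : ‖q‖ < 1) (x : ℂ) (hx : x ≠ 0) :
    Efun q x * Efun q x⁻¹ = ∑' n : ℤ, cc q n * x^n := by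
  have hx' := inv_ne_zero hx
  unfold Efun
  rw [tsum_mul_tsum_of_summable_norm (summable_eZ h0 h1 x hx) (summable_eZ h0 h1 _ hx')]
  let e : ℤ × ℤ ≃ ℤ × ℤ := ⟨fun p => (p.1+p.2, p.2), fun p => (p.1-p.2, p.2),
    fun p => by simp, fun p => by simp⟩
  rw [← e.tsum_eq]
  have := summable_prod h0 h1 x _ hx hx'
  change ∑' p : ℤ × ℤ, eZ q (p.1+p.2) * x^(p.1+p.2) * (eZ q p.2 * x⁻¹^p.2) = _
  rw [this.tsum_prod]
  congr 1; funext n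
  unfold cc
  rw [← tsum_mul_right]
  congr 1; funext m
  rw [zpow_add₀ hx, inv_zpow]
  field_simp

lemma cc_summable {q : ℂ} (h0 : q ≠ 0) (h1 : ‖q‖ < 1) (n : ℤ) (x : ℂ) (hx : x ≠ 0) :
    Summable (fun m : ℤ => eZ q (n+m) * eZ q m * x^m) := by
  have := (summable_prod h0 h1 1 x one_ne_zero hx).prod_factor n
  refine this.congr fun m => ?_
  simp; ring

lemma cc_rec {q : ℂ} (h0 : q ≠ 0) (h1 : ‖q‖ < 1) (n : ℤ) :
    cc q n = q^(2*n-1) * cc q (n-1) := by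
  have s1 : Summable (fun m : ℤ => eZ q (n+m) * eZ q m) := by
    simpa using cc_summable h0 h1 n 1 one_ne_zero
  have s2 : Summable (fun m : ℤ => eZ q (n-1+m) * eZ q m) := by
    simpa using cc_summable h0 h1 (n-1) 1 one_ne_zero
  have s3 : Summable (fun m : ℤ => q^(2*n) * (eZ q (n+m) * eZ q m * (q^2)^m)) :=
    (cc_summable h0 h1 n (q^2) (by positivity)).mul_left _
  have s4 : Summable (fun m : ℤ => q^(2*n) * (eZ q (n+(m-1)) * eZ q (m-1) * (q^2)^(m-1))) :=
    (Equiv.subRight (1:ℤ)).summable_iff.2 s3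
  have t4 : ∑' m : ℤ, q^(2*n) * (eZ q (n+(m-1)) * eZ q (m-1) * (q^2)^(m-1)) = ∑' m : ℤ, q^(2*n) * (eZ q (n+m) * eZ q m * (q^2)^m) :=
    (Equiv.subRight (1:ℤ)).tsum_eq (fun m : ℤ => q^(2*n) * (eZ q (n+m) * eZ q m * (q^2)^m))
  have key : cc q n - q^(2*n-1) * cc q (n-1) = 0 := by
    unfold cc
    rw [← tsum_mul_left, ← s1.tsum_sub (s2.mul_left _)]
    rw [← sub_eq_zero.2 t4.symm, ← s3.tsum_sub s4]
    congr 1; funext m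
    have r1 := eZ_rec h0 h1 (n+m)
    have r2 := eZ_rec h0 h1 m
    rw [show n + m - 1 = n - 1 + m by ring] at r1
    rw [show n + (m - 1) = n - 1 + m by ring]
    have z1 : q^(2*(n+m)) = q^(2*n) * q^(2*m) := by rw [← zpow_add₀ h0]; ring_nf
    have z2 : q^(2*(n+m)-1) = q^(2*n-1) * q^(2*m) := by rw [← zpow_add₀ h0]; ring_nf
    have z3 : (q^2)^m = q^(2*m) := by rw [zpow_mul]; norm_cast
    have z4 : q^(2*n) * (q^2)^(m-1) = q^(2*n-1) * q^(2*m-1) := by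
      rw [show q^2 = q^(2:ℤ) by norm_cast, ← zpow_mul, ← zpow_add₀ h0, ← zpow_add₀ h0]; ring_nf
    rw [z1, z2] at r1
    rw [z3]
    linear_combination eZ q m * r1 - q^(2*n-1) * eZ q (n-1+m) * r2 +
      eZ q (n-1+m) * eZ q (m-1) * z4
  linear_combination key

lemma cc_eq {q : ℂ} (h0 : q ≠ 0) (h1 : ‖q‖ < 1) (n : ℤ) : cc q n = q^(n^2) * cc q 0 := by
  induction n using Int.induction_on with
  | zero => simp
  | succ i ih =>
    rw [cc_rec h0 h1, add_sub_cancel_right, ih, ← mul_assoc, ← zpow_add₀ h0]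
    ring_nf
  | pred i ih =>
    have := cc_rec h0 h1 (-(i:ℤ))
    rw [ih] at this
    have h3 : cc q (-(i:ℤ)-1) = (q^(2*(-(i:ℤ))-1))⁻¹ * (q^((-(i:ℤ))^2) * cc q 0) := by
      rw [this]; field_simp
    rw [h3, ← zpow_neg, ← mul_assoc, ← zpow_add₀ h0]
    ring_nf

lemma theta_ne {q : ℂ} (h0 : q ≠ 0) (h1 : ‖q‖ < 1) (x : ℂ) (hx : x ≠ 0)
    (ha : ∀ k : ℤ, 1 + q^(2*k+1) * x ≠ 0) : ∑' n : ℤ, q^(n^2) * x^n ≠ 0 := by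
  have e := E_mul_E h0 h1 x hx
  have : ∀ n, cc q n * x^n = cc q 0 * (q^(n^2) * x^n) := fun n => by rw [cc_eq h0 h1 n]; ring
  simp_rw [this] at e
  rw [tsum_mul_left] at e
  have g1 : Efun q x ≠ 0 := by
    apply Efun_ne h0 h1 x hx
    intro k
    exact_mod_cast ha k
  have g2 : Efun q x⁻¹ ≠ 0 := by
    apply Efun_ne h0 h1 _ (inv_ne_zero hx)
    intro k h
    apply ha (-(k:ℤ)-1)
    have : q^(2*(-(k:ℤ)-1)+1) = (q^(2*k+1))⁻¹ := by
      rw [← zpow_natCast, ← zpow_neg]; congr 1; push_cast; ring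
    rw [this]
    field_simp at h ⊢
    linear_combination h
  intro h
  rw [h, mul_zero] at e
  exact mul_ne_zero g1 g2 e

def JJ (α w T : ℂ) : ℂ :=
  ∑' n : ℤ, Complex.exp (Real.pi * Complex.I * T * ((n : ℂ) + α) ^ 2 +
    2 * Real.pi * Complex.I * ((n : ℂ) + α) * w)

lemma JJ_term (α w T : ℂ) (n : ℤ) :
    Complex.exp (Real.pi * Complex.I * T * ((n : ℂ) + α) ^ 2 +
      2 * Real.pi * Complex.I * ((n : ℂ) + α) * w) =
    Complex.exp (Real.pi * I * T * α^2 + 2 * Real.pi * I * α * w) *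
      jacobiTheta₂_term n (w + α * T) T := by
  unfold jacobiTheta₂_term
  rw [← Complex.exp_add]
  congr 1; ring

lemma JJ_summable (α w : ℂ) {T : ℂ} (hT : 0 < T.im) :
    Summable (fun n : ℤ => ‖Complex.exp (Real.pi * Complex.I * T * ((n : ℂ) + α) ^ 2 +
      2 * Real.pi * Complex.I * ((n : ℂ) + α) * w)‖) := by
  simp_rw [JJ_term]
  exact (((summable_jacobiTheta₂_term_iff (w + α * T) T).2 hT).mul_left _).norm

lemma JJ_zero (α w T : ℂ) :
    JJ α w T = Complex.exp (Real.pi * I * T * α^2 + 2 * Real.pi * I * α * w) *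
      JJ 0 (w + α * T) T := by
  unfold JJ
  rw [← tsum_mul_left]
  refine tsum_congr fun n => ?_
  rw [← Complex.exp_add]
  congr 1; ring

lemma JJ_add_one (α w T : ℂ) : JJ (α + 1) w T = JJ α w T := by
  unfold JJ
  rw [← (Equiv.addRight (1:ℤ)).tsum_eq (fun n : ℤ => Complex.exp (Real.pi * Complex.I * T * ((n : ℂ) + α) ^ 2 +
      2 * Real.pi * Complex.I * ((n : ℂ) + α) * w))]
  refine tsum_congr fun n => ?_
  simp only [Equiv.coe_addRight]
  push_cast
  congr 1; ring

lemma JJ_neg (α w T : ℂ) : JJ α (-w) T = JJ (-α) w T := by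
  unfold JJ
  rw [← (Equiv.neg ℤ).tsum_eq]
  refine tsum_congr fun n => ?_
  simp only [Equiv.neg_apply]
  push_cast
  congr 1; ring

lemma JJ_one (α w T : ℂ) : JJ α (w + 1) T = Complex.exp (2 * Real.pi * I * α) * JJ α w T := by
  unfold JJ
  rw [← tsum_mul_left]
  refine tsum_congr fun n => ?_
  rw [← Complex.exp_add, Complex.exp_eq_exp_iff_exists_int]
  exact ⟨n, by ring⟩

lemma JJ_shift (α w T : ℂ) (k : ℤ) :
    JJ α (w + k * T) T = Complex.exp (-(Real.pi * I * T * k^2) - 2 * Real.pi * I * k * w) * JJ α w T := by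
  unfold JJ
  rw [← tsum_mul_left, ← (Equiv.addRight k).tsum_eq (fun n : ℤ =>
    Complex.exp (-(Real.pi * I * T * k^2) - 2 * Real.pi * I * k * w) *
    Complex.exp (Real.pi * Complex.I * T * ((n : ℂ) + α) ^ 2 +
      2 * Real.pi * Complex.I * ((n : ℂ) + α) * w))]
  refine tsum_congr fun n => ?_
  simp only [Equiv.coe_addRight]
  rw [← Complex.exp_add]
  push_cast
  congr 1; ring

lemma JJ_prod (α x y : ℂ) {T : ℂ} (hT : 0 < T.im) :
    JJ α (x + y) T * JJ α (x - y) T =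
      JJ α (2*x) (2*T) * JJ 0 (2*y) (2*T) + JJ (α+1/2) (2*x) (2*T) * JJ (1/2) (2*y) (2*T) := by
  have hT2 : 0 < (2*T).im := by simpa using hT
  let e : (ℤ × ℤ) ⊕ (ℤ × ℤ) ≃ ℤ × ℤ :=
    { toFun := Sum.elim (fun p => (p.1+p.2, p.1-p.2)) (fun p => (p.1+p.2+1, p.1-p.2))
      invFun := fun p => if (p.1+p.2) % 2 = 0 then Sum.inl ((p.1+p.2)/2, (p.1-p.2)/2)
        else Sum.inr ((p.1+p.2-1)/2, (p.1-p.2-1)/2)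
      left_inv := by
        rintro (⟨p, q⟩ | ⟨p, q⟩)
        · have : (p + q + (p - q)) % 2 = 0 := by omega
          simp only [Sum.elim_inl, this, if_true]
          congr 2 <;> omega
        · have : ¬ (p + q + 1 + (p - q)) % 2 = 0 := by omega
          simp only [Sum.elim_inr, this, if_false]
          congr 2 <;> omega
      right_inv := by
        rintro ⟨m, n⟩
        by_cases h : (m+n) % 2 = 0
        · simp only [h, if_true, Sum.elim_inl]
          congr 1 <;> omega
        · simp only [h, if_false, Sum.elim_inr]
          congr 1 <;> omega }
  have hs := summable_mul_of_summable_norm (JJ_summable α (x+y) hT) (JJ_summable α (x-y) hT)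
  have hs1 := summable_mul_of_summable_norm (JJ_summable α (2*x) hT2) (JJ_summable 0 (2*y) hT2)
  have hs2 := summable_mul_of_summable_norm (JJ_summable (α+1/2) (2*x) hT2) (JJ_summable (1/2) (2*y) hT2)
  have h1 := (JJ_summable α (x+y) hT).of_norm.hasSum.mul (JJ_summable α (x-y) hT).of_norm.hasSum hs
  have h2 := (JJ_summable α (2*x) hT2).of_norm.hasSum.mul (JJ_summable 0 (2*y) hT2).of_norm.hasSum hs1
  have h3 := (JJ_summable (α+1/2) (2*x) hT2).of_norm.hasSum.mul
    (JJ_summable (1/2) (2*y) hT2).of_norm.hasSum hs2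
  rw [← e.hasSum_iff] at h1
  refine h1.unique (HasSum.sum ?_ ?_)
  · convert h2 using 1
    · funext p
      simp only [Function.comp, e, Equiv.coe_fn_mk, Sum.elim_inl]
      rw [← Complex.exp_add, ← Complex.exp_add]
      push_cast
      congr 1; ring
    · rfl
  · convert h3 using 1
    · funext p
      simp only [Function.comp, e, Equiv.coe_fn_mk, Sum.elim_inr]
      rw [← Complex.exp_add, ← Complex.exp_add]
      push_cast
      congr 1; ring
    · rfl

lemma JJ_ne (w : ℂ) {T : ℂ} (hT : 0 < T.im) (h : JJ 0 w T = 0) :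
    ∃ k n : ℤ, w = k * T + T/2 + n + 1/2 := by
  by_contra hc
  push Not at hc
  refine theta_ne (q := Complex.exp (Real.pi * I * T)) (Complex.exp_ne_zero _) ?_
    (Complex.exp (2 * Real.pi * I * w)) (Complex.exp_ne_zero _) ?_ ?_
  · rw [Complex.norm_exp, Real.exp_lt_one_iff]
    simp
    positivity
  · intro k hk
    rw [← Complex.exp_int_mul, ← Complex.exp_add] at hk
    have h2 : Complex.exp (((2*k+1 : ℤ) : ℂ) * (Real.pi * I * T) + 2 * Real.pi * I * w) =
        Complex.exp (Real.pi * I) := by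
      rw [Complex.exp_pi_mul_I]; linear_combination hk
    rw [Complex.exp_eq_exp_iff_exists_int] at h2
    obtain ⟨n, hn⟩ := h2
    apply hc (-k-1) n
    have hpi : (2 * Real.pi * I : ℂ) ≠ 0 := Complex.two_pi_I_ne_zero
    apply mul_left_cancel₀ hpi
    push_cast at hn ⊢
    linear_combination hn
  · rw [← h]
    unfold JJ
    refine tsum_congr fun n => ?_
    rw [← Complex.exp_int_mul, ← Complex.exp_int_mul, ← Complex.exp_add]
    congr 1; push_cast; ring

lemma jTheta_JJ (a b : ℝ) (z τ : ℂ) : jTheta a b z τ = JJ a (z + b) τ := rfl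

def AA (τ z : ℂ) : ℂ := JJ 0 (2*z) (2*τ)
def BB (τ z : ℂ) : ℂ := JJ (1/2) (2*z) (2*τ)

lemma exp_half : Complex.exp (2 * Real.pi * I * (1/2)) = -1 := by
  rw [← Complex.exp_pi_mul_I]; congr 1; ring

lemma JJ_half_half (w T : ℂ) : JJ (1/2+1/2) w T = JJ 0 w T := by
  rw [← JJ_add_one 0]; norm_num

lemma theta1_prod (x y : ℂ) {τ : ℂ} (h : 0 < τ.im) :
    theta1 (x+y) τ * theta1 (x-y) τ = AA τ x * BB τ y - BB τ x * AA τ y := by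
  have := JJ_prod (1/2) (x+1/2) y h
  rw [show 2*(x+1/2) = 2*x+1 by ring, JJ_half_half, JJ_one, JJ_one, exp_half] at this
  simp only [theta1, jTheta_JJ, AA, BB]
  push_cast
  rw [show x + y + 1/2 = x + 1/2 + y by ring, show x - y + 1/2 = x + 1/2 - y by ring]
  rw [mul_zero, Complex.exp_zero] at this
  linear_combination this

lemma theta2_prod (x y : ℂ) {τ : ℂ} (h : 0 < τ.im) :
    theta2 (x+y) τ * theta2 (x-y) τ = BB τ x * AA τ y + AA τ x * BB τ y := by
  have := JJ_prod (1/2) x y h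
  rw [JJ_half_half] at this
  simp only [theta2, jTheta_JJ, AA, BB]
  push_cast
  rw [add_zero, add_zero]
  exact this

lemma theta3_prod (x y : ℂ) {τ : ℂ} (h : 0 < τ.im) :
    theta3 (x+y) τ * theta3 (x-y) τ = AA τ x * AA τ y + BB τ x * BB τ y := by
  have := JJ_prod 0 x y h
  simp only [theta3, jTheta_JJ, AA, BB]
  push_cast
  rw [add_zero, add_zero]
  rw [zero_add] at this
  exact this

lemma theta4_prod (x y : ℂ) {τ : ℂ} (h : 0 < τ.im) :
    theta4 (x+y) τ * theta4 (x-y) τ = AA τ x * AA τ y - BB τ x * BB τ y := by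
  have := JJ_prod 0 (x+1/2) y h
  rw [show 2*(x+1/2) = 2*x+1 by ring, zero_add, JJ_one, JJ_one, exp_half, mul_zero,
    Complex.exp_zero] at this
  simp only [theta4, jTheta_JJ, AA, BB]
  push_cast
  rw [show x + y + 1/2 = x + 1/2 + y by ring, show x - y + 1/2 = x + 1/2 - y by ring]
  linear_combination this

lemma AA_neg (τ z : ℂ) : AA τ (-z) = AA τ z := by
  unfold AA
  rw [mul_neg, JJ_neg, neg_zero]

lemma BB_neg (τ z : ℂ) : BB τ (-z) = BB τ z := by
  unfold BB
  rw [mul_neg, JJ_neg, ← JJ_add_one]; norm_num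

lemma JJ_two (α w T : ℂ) (hα : Complex.exp (2 * Real.pi * I * α) ^ 2 = 1) (n : ℤ) :
    JJ α (w + 2 * n) T = JJ α w T := by
  have h2 : ∀ w, JJ α (w + 2) T = JJ α w T := by
    intro w
    rw [show w + 2 = w + 1 + 1 by ring, JJ_one, JJ_one, ← mul_assoc, ← sq, hα, one_mul]
  induction n using Int.induction_on with
  | zero => simp
  | succ i ih => rw [← ih, ← h2 (w + 2 * ((i:ℤ):ℂ))]; congr 1; push_cast; ring
  | pred i ih => rw [← ih, ← h2]; congr 1; push_cast; ring

lemma AB_shift (τ z : ℂ) (k n : ℤ) : ∃ μ : ℂ, μ ≠ 0 ∧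
    AA τ (z + k * τ + n) = μ * AA τ z ∧ BB τ (z + k * τ + n) = μ * BB τ z := by
  refine ⟨_, Complex.exp_ne_zero (-(Real.pi * I * (2*τ) * k^2) - 2 * Real.pi * I * k * (2*z)), ?_, ?_⟩
  · unfold AA
    rw [← JJ_shift, show 2 * (z + k*τ + n) = 2*z + k*(2*τ) + 2*n by ring, JJ_two]
    simp
  · unfold BB
    rw [← JJ_shift, show 2 * (z + k*τ + n) = 2*z + k*(2*τ) + 2*n by ring, JJ_two]
    rw [exp_half]; norm_num

lemma theta1_zero {τ w : ℂ} (h : 0 < τ.im) (hw : theta1 w τ = 0) :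
    ∃ k n : ℤ, w = k * τ + n := by
  simp only [theta1, jTheta_JJ] at hw
  rw [neg_eq_zero, JJ_zero, mul_eq_zero, or_iff_right (Complex.exp_ne_zero _)] at hw
  obtain ⟨k, n, hk⟩ := JJ_ne _ h hw
  refine ⟨k, n, ?_⟩
  push_cast at hk
  linear_combination hk

lemma indep {τ : ℂ} (h : 0 < τ.im) (k n : ℤ) (hk : (k:ℂ) * τ + n = 0) : k = 0 ∧ n = 0 := by
  have h1 := congrArg Complex.im hk
  simp at h1
  have hk0 : k = 0 := by
    rcases h1 with h1 | h1
    · exact h1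
    · exact absurd h1 h.ne'
  subst hk0
  simp at hk
  exact ⟨rfl, hk⟩

lemma theta2_ne {τ : ℂ} (h : 0 < τ.im) : theta2 0 τ ≠ 0 := by
  intro hw
  simp only [theta2, jTheta_JJ] at hw
  rw [JJ_zero, mul_eq_zero, or_iff_right (Complex.exp_ne_zero _)] at hw
  obtain ⟨k, n, hk⟩ := JJ_ne _ h hw
  push_cast at hk
  have := (indep h (2*k) (2*n+1) (by push_cast; linear_combination -2*hk)).2
  omega

lemma theta3_ne {τ : ℂ} (h : 0 < τ.im) : theta3 0 τ ≠ 0 := by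
  intro hw
  simp only [theta3, jTheta_JJ] at hw
  obtain ⟨k, n, hk⟩ := JJ_ne _ h (by simpa using hw)
  have := (indep h (2*k+1) (2*n+1) (by push_cast; linear_combination -2*hk)).2
  omega

lemma theta4_ne {τ : ℂ} (h : 0 < τ.im) : theta4 0 τ ≠ 0 := by
  intro hw
  simp only [theta4, jTheta_JJ] at hw
  obtain ⟨k, n, hk⟩ := JJ_ne (0+1/2) h (by simpa using hw)
  have := (indep h (2*k+1) (2*n) (by push_cast; linear_combination -2*hk)).1
  omega

def pt (τ : ℂ) (l m : ℤ) : ℂ := l * τ / 3 + m / 3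

lemma pt_zero {τ : ℂ} (h : 0 < τ.im) (l m : ℤ) (h0 : theta1 (pt τ l m) τ = 0) :
    (3:ℤ) ∣ l ∧ (3:ℤ) ∣ m := by
  obtain ⟨k, n, hk⟩ := theta1_zero h h0
  unfold pt at hk
  have := indep h (l-3*k) (m-3*n) (by push_cast; linear_combination 3*hk)
  omega

def DD (τ u : ℂ) : ℂ := AA τ 0 * BB τ u - BB τ 0 * AA τ u

def SS (τ u : ℂ) : ℂ := BB τ u / DD τ u

lemma DD_eq {τ : ℂ} (h : 0 < τ.im) (u : ℂ) : theta1 u τ * theta1 (-u) τ = DD τ u := by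
  have := theta1_prod 0 u h
  rw [zero_add, zero_sub] at this
  exact this

lemma theta1_neg (τ u : ℂ) : theta1 (-u) τ = - theta1 u τ := by
  simp only [theta1, jTheta_JJ]
  push_cast
  rw [show -u + 1/2 = -(u - 1/2) by ring, JJ_neg, ← JJ_add_one,
    show u + 1/2 = u - 1/2 + 1 by ring, JJ_one, exp_half]
  norm_num

lemma DD_ne {τ : ℂ} (h : 0 < τ.im) (u : ℂ) (hu : theta1 u τ ≠ 0) : DD τ u ≠ 0 := by
  rw [← DD_eq h, theta1_neg]
  exact mul_ne_zero hu (neg_ne_zero.2 hu)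

lemma alg_root (a b A B D s μ : ℂ) (hb : b ≠ 0) (hD : D ≠ 0) (hDe : D = a*B - b*A)
    (hs : s = B / D) (h1 : (A^2+B^2)^2 = (a^2+b^2) * (μ * (A*a+B*b)))
    (h2 : (2*A*B)^2 = 2*a*b*(μ*(A*b+B*a))) :
    3*a*(a^2+b^2)*(b^2-a^2)*s^4 + (8*a^4+4*a^2*(a^2+b^2)-2*(a^2+b^2)^2)*s^3
      - 12*a^3*s^2 + 6*a^2*s - a = 0 := by
  have hB : B = s * D := by rw [hs]; field_simp
  have hA : A = (a*s-1)*(D/b) := by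
    field_simp
    linear_combination a * hB + hDe
  have h3 : (A^2+B^2)^2 * (2*a*b*(A*b+B*a)) = (2*A*B)^2 * ((a^2+b^2)*(A*a+B*b)) := by
    rw [h1, h2]; ring
  have hB' : B = (b*s) * (D/b) := by rw [hB]; field_simp
  have hE : D/b ≠ 0 := div_ne_zero hD hb
  generalize D/b = E at *
  subst hA hB'
  have : (E^5 * (2*b^2)) * (3*a*(a^2+b^2)*(b^2-a^2)*s^4 + (8*a^4+4*a^2*(a^2+b^2)-2*(a^2+b^2)^2)*s^3
      - 12*a^3*s^2 + 6*a^2*s - a) = 0 := by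
    linear_combination h3
  exact (mul_eq_zero.1 this).resolve_left
    (mul_ne_zero (pow_ne_zero _ hE) (mul_ne_zero two_ne_zero (pow_ne_zero _ hb)))

lemma vieta4 (c4 c3 c2 c1 c0 x y z w : ℂ)
    (hxy : x ≠ y) (hxz : x ≠ z) (hxw : x ≠ w) (hyz : y ≠ z) (hyw : y ≠ w) (hzw : z ≠ w)
    (hx : c4*x^4+c3*x^3+c2*x^2+c1*x+c0 = 0) (hy : c4*y^4+c3*y^3+c2*y^2+c1*y+c0 = 0)
    (hz : c4*z^4+c3*z^3+c2*z^2+c1*z+c0 = 0) (hw : c4*w^4+c3*w^3+c2*w^2+c1*w+c0 = 0) :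
    c4*(x+y+z+w) + c3 = 0 := by
  have d1 : ∀ y, x ≠ y → c4*y^4+c3*y^3+c2*y^2+c1*y+c0 = 0 →
      c4*(x^3+x^2*y+x*y^2+y^3)+c3*(x^2+x*y+y^2)+c2*(x+y)+c1 = 0 := by
    intro y h hy
    apply mul_left_cancel₀ (sub_ne_zero.2 h)
    linear_combination hx - hy
  have a1 := d1 y hxy hy
  have d2 : ∀ z, x ≠ z → y ≠ z → c4*z^4+c3*z^3+c2*z^2+c1*z+c0 = 0 →
      c4*(x^2+x*y+x*z+y^2+y*z+z^2)+c3*(x+y+z)+c2 = 0 := by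
    intro z h h' hz
    apply mul_left_cancel₀ (sub_ne_zero.2 h')
    linear_combination a1 - d1 z h hz
  have a2 := d2 z hxz hyz hz
  apply mul_left_cancel₀ (sub_ne_zero.2 hzw)
  linear_combination a2 - d2 w hxw hyw hw

lemma SS_root {τ : ℂ} (h : 0 < τ.im) (u : ℂ) (k n : ℤ) (hu : theta1 u τ ≠ 0)
    (h3 : 3 * u = k * τ + n) (a b : ℂ) (ha : a = AA τ 0) (hb : b = BB τ 0) (hb0 : b ≠ 0) :
    (3*a*(a^2+b^2)*(b^2-a^2))*SS τ u^4 + (8*a^4+4*a^2*(a^2+b^2)-2*(a^2+b^2)^2)*SS τ u^3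
      + (-12*a^3)*SS τ u^2 + 6*a^2*SS τ u + (-a) = 0 := by
  obtain ⟨μ, -, hA, hB⟩ := AB_shift τ (-u) k n
  rw [show -u + k*τ + n = u + u by linear_combination -h3] at hA hB
  rw [AA_neg] at hA
  rw [BB_neg] at hB
  have e1 := theta3_prod u u h
  have e2 := theta3_prod (u+u) 0 h
  have e3 := theta3_prod 0 0 h
  have f1 := theta2_prod u u h
  have f2 := theta2_prod (u+u) 0 h
  have f3 := theta2_prod 0 0 h
  simp only [sub_self, add_zero, sub_zero] at e1 e2 e3 f1 f2 f3
  rw [hA, hB, ← ha, ← hb] at e2 f2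
  rw [← ha, ← hb] at e3 f3
  have := alg_root a b (AA τ u) (BB τ u) (DD τ u) (SS τ u) μ hb0 (DD_ne h u hu)
    (by rw [ha, hb]; rfl) rfl
    (by
      linear_combination (-(AA τ u^2 + BB τ u^2) - theta3 (u+u) τ * theta3 0 τ) * e1 +
        theta3 0 τ ^2 * e2 + (μ * (AA τ u * a + BB τ u * b)) * e3)
    (by
      linear_combination (-(2 * AA τ u * BB τ u) - theta2 (u+u) τ * theta2 0 τ) * f1 +
        theta2 0 τ ^2 * f2 + (μ * (AA τ u * b + BB τ u * a)) * f3)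
  linear_combination this

lemma SS_neg (τ u v : ℂ) (k n : ℤ) (hv : v = -u + k * τ + n) : SS τ v = SS τ u := by
  obtain ⟨μ, h0, hA, hB⟩ := AB_shift τ (-u) k n
  rw [← hv] at hA hB
  rw [AA_neg] at hA
  rw [BB_neg] at hB
  unfold SS DD
  rw [hA, hB, show AA τ 0 * (μ * BB τ u) - BB τ 0 * (μ * AA τ u) =
    μ * (AA τ 0 * BB τ u - BB τ 0 * AA τ u) by ring, mul_div_mul_left _ _ h0]

lemma SS_inj {τ : ℂ} (h : 0 < τ.im) (hb0 : BB τ 0 ≠ 0) (u v : ℂ)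
    (hu : theta1 u τ ≠ 0) (hv : theta1 v τ ≠ 0)
    (h1 : theta1 (u+v) τ ≠ 0) (h2 : theta1 (u-v) τ ≠ 0) : SS τ u ≠ SS τ v := by
  intro he
  unfold SS at he
  rw [div_eq_div_iff (DD_ne h u hu) (DD_ne h v hv)] at he
  have := theta1_prod u v h
  apply mul_ne_zero hb0 (mul_ne_zero h1 h2)
  rw [this]
  unfold DD at he
  linear_combination he

lemma SS_pt_inj {τ : ℂ} (h : 0 < τ.im) (hb0 : BB τ 0 ≠ 0) (l m l' m' : ℤ)
    (h1 : ¬ (3 ∣ l ∧ 3 ∣ m)) (h2 : ¬ (3 ∣ l' ∧ 3 ∣ m'))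
    (h3 : ¬ (3 ∣ l + l' ∧ 3 ∣ m + m')) (h4 : ¬ (3 ∣ l - l' ∧ 3 ∣ m - m')) :
    SS τ (pt τ l m) ≠ SS τ (pt τ l' m') := by
  apply SS_inj h hb0
  · exact fun hh => h1 (pt_zero h _ _ hh)
  · exact fun hh => h2 (pt_zero h _ _ hh)
  · intro hh
    apply h3 (pt_zero h _ _ _)
    rw [← hh]; congr 1; unfold pt; push_cast; ring
  · intro hh
    apply h4 (pt_zero h _ _ _)
    rw [← hh]; congr 1; unfold pt; push_cast; ring

lemma term_eq {τ : ℂ} (h : 0 < τ.im) (hb0 : BB τ 0 ≠ 0) (z : ℂ) (l m : ℤ)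
    (h1 : ¬ (3 ∣ l ∧ 3 ∣ m)) :
    theta1 (z + l * τ / 3 + m / 3) τ * theta1 (z - l * τ / 3 - m / 3) τ /
      (theta1 (l * τ / 3 + m / 3) τ * theta1 (-(l * τ / 3) - m / 3) τ) =
    BB τ z / BB τ 0 + SS τ (pt τ l m) * (AA τ z - BB τ z * AA τ 0 / BB τ 0) := by
  have hu : theta1 (pt τ l m) τ ≠ 0 := fun hh => h1 (pt_zero h _ _ hh)
  have hD := DD_ne h _ hu
  have e1 : z + l * τ / 3 + m / 3 = z + pt τ l m := by unfold pt; ring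
  have e2 : z - l * τ / 3 - m / 3 = z - pt τ l m := by unfold pt; ring
  have e3 : l * τ / 3 + m / 3 = pt τ l m := by unfold pt; ring
  have e4 : -(l * τ / 3) - m / 3 = -pt τ l m := by unfold pt; ring
  rw [e1, e2, e3, e4, theta1_prod _ _ h, DD_eq h]
  unfold SS
  field_simp
  unfold DD
  ring

theorem statement19 (τ z : ℂ) (hτ : 0 < τ.im) :
    -- all denominators are nonzero
    (∀ p : Fin 3 × Fin 3, p ≠ (0, 0) →
      theta1 (((p.1 : ℕ) : ℂ) * τ / 3 + ((p.2 : ℕ) : ℂ) / 3) τ ≠ 0 ∧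
      theta1 (-(((p.1 : ℕ) : ℂ) * τ / 3) - ((p.2 : ℕ) : ℂ) / 3) τ ≠ 0) ∧
    theta2 0 τ ≠ 0 ∧ theta3 0 τ ≠ 0 ∧ theta4 0 τ ≠ 0 ∧
    -- the theta identity
    3 * ∑ p ∈ Finset.univ.filter (fun p : Fin 3 × Fin 3 => p ≠ (0, 0)),
        theta1 (z + ((p.1 : ℕ) : ℂ) * τ / 3 + ((p.2 : ℕ) : ℂ) / 3) τ *
          theta1 (z - ((p.1 : ℕ) : ℂ) * τ / 3 - ((p.2 : ℕ) : ℂ) / 3) τ /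
        (theta1 (((p.1 : ℕ) : ℂ) * τ / 3 + ((p.2 : ℕ) : ℂ) / 3) τ *
          theta1 (-(((p.1 : ℕ) : ℂ) * τ / 3) - ((p.2 : ℕ) : ℂ) / 3) τ)
      = 8 * ((theta2 z τ / theta2 0 τ) ^ 2 + (theta3 z τ / theta3 0 τ) ^ 2 +
          (theta4 z τ / theta4 0 τ) ^ 2) := by
  have hp : ∀ p : Fin 3 × Fin 3, p ≠ (0, 0) →
      ¬ ((3:ℤ) ∣ ((p.1 : ℕ) : ℤ) ∧ (3:ℤ) ∣ ((p.2 : ℕ) : ℤ)) := by decide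
  have t2 := theta2_ne hτ
  have t3 := theta3_ne hτ
  have t4 := theta4_ne hτ
  refine ⟨?_, t2, t3, t4, ?_⟩
  · intro p hp0
    have hu : theta1 (pt τ ((p.1 : ℕ) : ℤ) ((p.2 : ℕ) : ℤ)) τ ≠ 0 :=
      fun hh => hp p hp0 (pt_zero hτ _ _ hh)
    have hu' : theta1 (-pt τ ((p.1 : ℕ) : ℤ) ((p.2 : ℕ) : ℤ)) τ ≠ 0 := by
      rw [theta1_neg]; exact neg_ne_zero.2 hu
    unfold pt at hu hu'
    push_cast at hu hu'
    rw [neg_add'] at hu'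
    exact ⟨hu, hu'⟩
  · have q2 := theta2_prod 0 0 hτ
    have q3 := theta3_prod 0 0 hτ
    have q4 := theta4_prod 0 0 hτ
    have r2 := theta2_prod z 0 hτ
    have r3 := theta3_prod z 0 hτ
    have r4 := theta4_prod z 0 hτ
    simp only [sub_self, add_zero, sub_zero, ← sq] at q2 q3 q4 r2 r3 r4
    have n2 : 2 * AA τ 0 * BB τ 0 ≠ 0 := by
      have := pow_ne_zero 2 t2
      rw [q2] at this
      intro h; apply this; linear_combination h
    have n3 : AA τ 0 ^ 2 + BB τ 0 ^ 2 ≠ 0 := by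
      rw [← q3]; exact pow_ne_zero 2 t3
    have n4 : AA τ 0 ^ 2 - BB τ 0 ^ 2 ≠ 0 := by
      rw [← q4]; exact pow_ne_zero 2 t4
    have ha0 : AA τ 0 ≠ 0 := fun h => n2 (by rw [h]; ring)
    have hb0 : BB τ 0 ≠ 0 := fun h => n2 (by rw [h]; ring)
    have hsum : ∑ p ∈ Finset.univ.filter (fun p : Fin 3 × Fin 3 => p ≠ (0, 0)),
        theta1 (z + ((p.1 : ℕ) : ℂ) * τ / 3 + ((p.2 : ℕ) : ℂ) / 3) τ *
          theta1 (z - ((p.1 : ℕ) : ℂ) * τ / 3 - ((p.2 : ℕ) : ℂ) / 3) τ /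
        (theta1 (((p.1 : ℕ) : ℂ) * τ / 3 + ((p.2 : ℕ) : ℂ) / 3) τ *
          theta1 (-(((p.1 : ℕ) : ℂ) * τ / 3) - ((p.2 : ℕ) : ℂ) / 3) τ)
       = ∑ p ∈ Finset.univ.filter (fun p : Fin 3 × Fin 3 => p ≠ (0, 0)),
        (BB τ z / BB τ 0 + SS τ (pt τ ((p.1 : ℕ) : ℤ) ((p.2 : ℕ) : ℤ)) *
          (AA τ z - BB τ z * AA τ 0 / BB τ 0)) := by
      refine Finset.sum_congr rfl fun p hp1 => ?_
      have := term_eq hτ hb0 z _ _ (hp p (Finset.mem_filter.1 hp1).2)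
      push_cast at this
      exact this
    have hfil : Finset.univ.filter (fun p : Fin 3 × Fin 3 => p ≠ (0, 0)) =
        {(0,1), (0,2), (1,0), (1,1), (1,2), (2,0), (2,1), (2,2)} := by decide
    have i1 : SS τ (pt τ 0 2) = SS τ (pt τ 0 1) := SS_neg τ _ _ 0 1 (by unfold pt; push_cast; ring)
    have i2 : SS τ (pt τ 2 0) = SS τ (pt τ 1 0) := SS_neg τ _ _ 1 0 (by unfold pt; push_cast; ring)
    have i3 : SS τ (pt τ 2 2) = SS τ (pt τ 1 1) := SS_neg τ _ _ 1 1 (by unfold pt; push_cast; ring)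
    have i4 : SS τ (pt τ 2 1) = SS τ (pt τ 1 2) := SS_neg τ _ _ 1 1 (by unfold pt; push_cast; ring)
    have root : ∀ l m : ℤ, ¬ (3 ∣ l ∧ 3 ∣ m) → _ := fun l m hlm =>
      SS_root hτ (pt τ l m) l m (fun hh => hlm (pt_zero hτ _ _ hh)) (by unfold pt; ring)
        (AA τ 0) (BB τ 0) rfl rfl hb0
    have V := vieta4 _ _ _ _ _ (SS τ (pt τ 0 1)) (SS τ (pt τ 1 0)) (SS τ (pt τ 1 1))
      (SS τ (pt τ 1 2))
      (SS_pt_inj hτ hb0 _ _ _ _ (by decide) (by decide) (by decide) (by decide))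
      (SS_pt_inj hτ hb0 _ _ _ _ (by decide) (by decide) (by decide) (by decide))
      (SS_pt_inj hτ hb0 _ _ _ _ (by decide) (by decide) (by decide) (by decide))
      (SS_pt_inj hτ hb0 _ _ _ _ (by decide) (by decide) (by decide) (by decide))
      (SS_pt_inj hτ hb0 _ _ _ _ (by decide) (by decide) (by decide) (by decide))
      (SS_pt_inj hτ hb0 _ _ _ _ (by decide) (by decide) (by decide) (by decide))
      (root 0 1 (by decide)) (root 1 0 (by decide)) (root 1 1 (by decide)) (root 1 2 (by decide))
    rw [hsum, hfil]
    have hex : ∀ f : Fin 3 × Fin 3 → ℂ, ∑ p ∈ ({(0,1), (0,2), (1,0), (1,1), (1,2), (2,0), (2,1),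
        (2,2)} : Finset (Fin 3 × Fin 3)), f p = f (0,1) + f (0,2) + f (1,0) + f (1,1) + f (1,2) +
          f (2,0) + f (2,1) + f (2,2) := by
      intro f
      rw [← hfil, Finset.sum_filter, Fintype.sum_prod_type]
      simp [Fin.sum_univ_three]
      ring
    rw [hex]
    change 3 * ((BB τ z / BB τ 0 + SS τ (pt τ 0 1) * (AA τ z - BB τ z * AA τ 0 / BB τ 0)) +
      (BB τ z / BB τ 0 + SS τ (pt τ 0 2) * (AA τ z - BB τ z * AA τ 0 / BB τ 0)) +
      (BB τ z / BB τ 0 + SS τ (pt τ 1 0) * (AA τ z - BB τ z * AA τ 0 / BB τ 0)) +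
      (BB τ z / BB τ 0 + SS τ (pt τ 1 1) * (AA τ z - BB τ z * AA τ 0 / BB τ 0)) +
      (BB τ z / BB τ 0 + SS τ (pt τ 1 2) * (AA τ z - BB τ z * AA τ 0 / BB τ 0)) +
      (BB τ z / BB τ 0 + SS τ (pt τ 2 0) * (AA τ z - BB τ z * AA τ 0 / BB τ 0)) +
      (BB τ z / BB τ 0 + SS τ (pt τ 2 1) * (AA τ z - BB τ z * AA τ 0 / BB τ 0)) +
      (BB τ z / BB τ 0 + SS τ (pt τ 2 2) * (AA τ z - BB τ z * AA τ 0 / BB τ 0))) = _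
    rw [i1, i2, i3, i4, div_pow, div_pow, div_pow, q2, q3, q4, r2, r3, r4]
    generalize SS τ (pt τ 0 1) = s1 at *
    generalize SS τ (pt τ 1 0) = s2 at *
    generalize SS τ (pt τ 1 1) = s3 at *
    generalize SS τ (pt τ 1 2) = s4 at *
    generalize AA τ 0 = a at *
    generalize BB τ 0 = b at *
    generalize AA τ z = A at *
    generalize BB τ z = B at *
    have hS : s1 + s2 + s3 + s4 = (8*a^4+4*a^2*(a^2+b^2)-2*(a^2+b^2)^2) /
        (3*a*(a^2+b^2)*(a^2-b^2)) := by
      rw [eq_div_iff (mul_ne_zero (mul_ne_zero (mul_ne_zero three_ne_zero ha0) n3) n4)]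
      linear_combination -V
    have e : 3 * ((B / b + s1 * (A - B * a / b)) + (B / b + s1 * (A - B * a / b)) +
        (B / b + s2 * (A - B * a / b)) + (B / b + s3 * (A - B * a / b)) +
        (B / b + s4 * (A - B * a / b)) + (B / b + s2 * (A - B * a / b)) +
        (B / b + s4 * (A - B * a / b)) + (B / b + s3 * (A - B * a / b))) =
        24 * (B / b) + 6 * (s1 + s2 + s3 + s4) * (A - B * a / b) := by ring
    rw [e, hS, show b * a + a * b = 2 * a * b by ring]
    field_simp
    ring
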